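/- Let X be a compact Hausdorff space, let K be a basic lattice of closed subsets of X, let Y be a compact topological space and let f : Y → X be continuous. Then the induced homomorphism h from K into the lattice of closed subsets of Y, given by h(a) = f⁻¹(a), is separative: for every a ∈ K and every closed set b ⊆ Y with f⁻¹(a) ∩ b = ∅ there exists c ∈ K with a ∩ c = ∅ and b ⊆ f⁻¹(c). -/

import Mathlib

/-- A basic lattice for a topological space `X`: a family of closed sets containing
`∅` and `X`, closed under finite unions and intersections, such that every closed
subset of `X` is an intersection of members of the family. -/
def IsBasicLattice {X : Type*} [TopologicalSpace X] (K : Set (Set X)) : Prop :=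
  (∀ a ∈ K, IsClosed a) ∧ (∅ : Set X) ∈ K ∧ Set.univ ∈ K ∧
  (∀ a ∈ K, ∀ b ∈ K, a ∪ b ∈ K) ∧ (∀ a ∈ K, ∀ b ∈ K, a ∩ b ∈ K) ∧
  (∀ c : Set X, IsClosed c → ∃ S ⊆ K, c = ⋂₀ S)

/-- Let `X` be compact Hausdorff, `K` a basic lattice of closed subsets of `X`,
`Y` compact, and `f : Y → X` continuous. Then the induced homomorphism
`a ↦ f⁻¹(a)` into the closed sets of `Y` is separative: whenever `f⁻¹(a) ∩ b = ∅`
with `b ⊆ Y` closed, there is `c ∈ K` with `a ∩ c = ∅` and `b ⊆ f⁻¹(c)`. -/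
theorem induced_homomorphism_separative {X Y : Type*}
    [TopologicalSpace X] [CompactSpace X] [T2Space X]
    [TopologicalSpace Y] [CompactSpace Y]
    (K : Set (Set X)) (hK : IsBasicLattice K)
    (f : Y → X) (hf : Continuous f) :
    ∀ a ∈ K, ∀ b : Set Y, IsClosed b → f ⁻¹' a ∩ b = ∅ →
      ∃ c ∈ K, a ∩ c = ∅ ∧ b ⊆ f ⁻¹' c := by
  obtain ⟨hclosed, -, huniv, -, hinter, hbase⟩ := hK
  intro a ha b hb hab
  have : Nonempty {c // c ∈ K ∧ f '' b ⊆ c} := ⟨⟨Set.univ, huniv, Set.subset_univ _⟩⟩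
  obtain ⟨S, hSK, hS⟩ := hbase _ (hb.isCompact.image hf).isClosed
  obtain ⟨⟨c, hcK, hbc⟩, hac⟩ := (hclosed a ha).isCompact.elim_directed_family_closed
    (fun c : {c // c ∈ K ∧ f '' b ⊆ c} ↦ c.1) (fun c ↦ hclosed _ c.2.1)
    (by
      rw [Set.eq_empty_iff_forall_notMem]
      rintro x ⟨hxa, hx⟩
      have hxb : x ∈ f '' b := by
        rw [hS]
        exact fun s hs ↦ Set.mem_iInter.mp hx
          ⟨s, hSK hs, hS.trans_subset (Set.sInter_subset_of_mem hs)⟩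
      obtain ⟨y, hy, rfl⟩ := hxb
      exact Set.eq_empty_iff_forall_notMem.mp hab y ⟨hxa, hy⟩)
    (fun c d ↦ ⟨⟨c.1 ∩ d.1, hinter _ c.2.1 _ d.2.1, Set.subset_inter c.2.2 d.2.2⟩,
      Set.inter_subset_left, Set.inter_subset_right⟩)
  exact ⟨c, hcK, hac, Set.image_subset_iff.mp hbc⟩
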